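/- Define q_{2k1+1, 2k2+1} = (ρ/α)² q_{2k1} q_{2k2} where ρ = 12, α² = 54, and q_{2k} = Z(2k+2)/(12 · 54^k) with Z as above. Then ∑_{k1,k2 ≥ 0} q_{2k1+1, 2k2+1} = 1/24. -/

import Mathlib

/-- `Z2 m` is the quantity `Z(2m)` from the paper: `Z(2) = 4/3` and
`Z(2m) = 8^m (3m-4)! / ((m-2)! (2m)!)` for `m ≥ 2`. -/
def Z2 (m : ℕ) : ℚ :=
  if m = 1 then 4/3
  else (8 : ℚ) ^ m * (Nat.factorial (3 * m - 4)) /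
    ((Nat.factorial (m - 2)) * (Nat.factorial (2 * m)))

/-- `q2 k` is `q_{2k} = Z(2k+2)/(12 · 54^k)`. -/
def q2 (k : ℕ) : ℚ := Z2 (k + 1) / (12 * 54 ^ k)

open Filter Topology Finset

/-- The `k`-th term of the hypergeometric series `₂F₁(-1/3, -2/3; c; 1)`. -/
noncomputable def hypTerm (c : ℝ) (k : ℕ) : ℝ :=
  ∏ j ∈ range k, ((j : ℝ) - 1 / 3) * (j - 2 / 3) / ((c + j) * (j + 1))

lemma hypTerm_zero (c : ℝ) : hypTerm c 0 = 1 := by simp [hypTerm]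

lemma hypTerm_succ (c : ℝ) (k : ℕ) :
    hypTerm c (k + 1) =
      hypTerm c k * (((k : ℝ) - 1 / 3) * (k - 2 / 3) / ((c + k) * (k + 1))) :=
  prod_range_succ _ _

lemma sub_third_mul_sub_two_thirds_pos (k : ℕ) : 0 < ((k : ℝ) - 1 / 3) * (k - 2 / 3) := by
  rcases k with _ | k
  · norm_num
  · push_cast
    have : (0 : ℝ) ≤ k := k.cast_nonneg
    nlinarith

lemma hypTerm_pos {c : ℝ} (hc : 0 < c) (k : ℕ) : 0 < hypTerm c k :=
  prod_pos fun j _ => div_pos (sub_third_mul_sub_two_thirds_pos j) (by positivity)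

lemma sq_mul_hypTerm_le {c : ℝ} (hc : 0 < c) (k : ℕ) :
    ((k : ℝ) + 1) ^ 2 * hypTerm c (k + 1) ≤ hypTerm c 1 := by
  induction k with
  | zero => simp
  | succ k ih =>
    refine le_trans ?_ ih
    rw [hypTerm_succ c (k + 1)]
    have hu := hypTerm_pos hc (k + 1)
    have hk : (0 : ℝ) ≤ k := k.cast_nonneg
    push_cast
    have key : ((k : ℝ) + 1 + 1) ^ 2 *
        (((k : ℝ) + 1 - 1 / 3) * (k + 1 - 2 / 3) / ((c + (k + 1)) * (k + 1 + 1)))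
        ≤ ((k : ℝ) + 1) ^ 2 := by
      rw [← mul_div_assoc, div_le_iff₀ (by positivity)]
      have h : ((k : ℝ) + 1 + 1) * (((k : ℝ) + 1 - 1 / 3) * (k + 1 - 2 / 3))
          ≤ ((k : ℝ) + 1) ^ 2 * (c + (k + 1)) := by
        nlinarith [mul_nonneg hc.le (sq_nonneg ((k : ℝ) + 1))]
      nlinarith [mul_le_mul_of_nonneg_left h (by positivity : (0 : ℝ) ≤ (k : ℝ) + 1 + 1)]
    nlinarith [mul_le_mul_of_nonneg_left key hu.le]

lemma hypTerm_succ_le {c : ℝ} (hc : 0 < c) (k : ℕ) :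
    hypTerm c (k + 1) ≤ hypTerm c 1 * (1 / ((k : ℝ) + 1) ^ 2) := by
  rw [mul_one_div, le_div_iff₀ (by positivity), mul_comm]
  exact sq_mul_hypTerm_le hc k

lemma summable_hypTerm {c : ℝ} (hc : 0 < c) : Summable (hypTerm c) := by
  rw [← summable_nat_add_iff 1]
  refine Summable.of_nonneg_of_le (fun k => (hypTerm_pos hc _).le) (hypTerm_succ_le hc) ?_
  refine Summable.mul_left _ ?_
  have h := (summable_nat_add_iff 1).2 (Real.summable_one_div_nat_pow.2 (one_lt_two))
  simpa using h

lemma tendsto_mul_hypTerm {c : ℝ} (hc : 0 < c) :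
    Tendsto (fun k : ℕ => (k : ℝ) * hypTerm c k) atTop (𝓝 0) := by
  rw [← tendsto_add_atTop_iff_nat 1]
  have h : Tendsto (fun k : ℕ => hypTerm c 1 * (1 / ((k : ℝ) + 1))) atTop (𝓝 0) := by
    simpa using (tendsto_one_div_add_atTop_nhds_zero_nat (𝕜 := ℝ)).const_mul (hypTerm c 1)
  refine squeeze_zero (fun k => ?_) (fun k => ?_) h
  · have := hypTerm_pos hc (k + 1)
    positivity
  · rw [mul_one_div, le_div_iff₀ (by positivity)]
    have := sq_mul_hypTerm_le hc k
    push_cast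
    linarith

lemma hypTerm_add_one {c : ℝ} (hc : 0 < c) (k : ℕ) :
    hypTerm (c + 1) k = hypTerm c k * (c / (c + k)) := by
  induction k with
  | zero => simp [hypTerm_zero, hc.ne']
  | succ k ih =>
    rw [hypTerm_succ, hypTerm_succ, ih]
    have hk : (0 : ℝ) ≤ k := k.cast_nonneg
    have h1 : c + k ≠ 0 := by positivity
    have h2 : c + 1 + k ≠ 0 := by positivity
    have h3 : c + (k + 1) ≠ 0 := by positivity
    push_cast
    field_simp
    ring

/-- A contiguity relation in the lower parameter, in telescoping form. -/
lemma hypTerm_contiguous {c : ℝ} (hc : 0 < c) (k : ℕ) :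
    c * (c + 1) * hypTerm c k - (c + 1 / 3) * (c + 2 / 3) * hypTerm (c + 1) k =
      c * (k * hypTerm c k - (k + 1 : ℕ) * hypTerm c (k + 1)) := by
  rw [hypTerm_succ, hypTerm_add_one hc]
  have h1 : c + k ≠ 0 := by positivity
  push_cast
  field_simp
  ring

lemma tsum_hypTerm_contiguous {c : ℝ} (hc : 0 < c) :
    c * (c + 1) * ∑' k, hypTerm c k =
      (c + 1 / 3) * (c + 2 / 3) * ∑' k, hypTerm (c + 1) k := by
  have h1 := ((summable_hypTerm hc).hasSum.mul_left (c * (c + 1))).sub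
    ((summable_hypTerm (by positivity : 0 < c + 1)).hasSum.mul_left
      ((c + 1 / 3) * (c + 2 / 3)))
  have h2 := h1.tendsto_sum_nat
  have h3 : Tendsto (fun n : ℕ => c * (0 - n * hypTerm c n)) atTop (𝓝 0) := by
    simpa using ((tendsto_mul_hypTerm hc).const_sub 0).const_mul c
  have h4 : (fun n : ℕ => ∑ k ∈ range n, (c * (c + 1) * hypTerm c k -
      (c + 1 / 3) * (c + 2 / 3) * hypTerm (c + 1) k)) =
      fun n : ℕ => c * (0 - n * hypTerm c n) := by
    funext n
    simp_rw [hypTerm_contiguous hc]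
    rw [← mul_sum, sum_range_sub' (fun k : ℕ => (k : ℝ) * hypTerm c k)]
    simp
  rw [h4] at h2
  exact sub_eq_zero.1 (tendsto_nhds_unique h2 h3)

lemma tsum_hypTerm_half_eq_prod_mul (n : ℕ) :
    ∑' k, hypTerm (1 / 2) k =
      (∏ j ∈ range n, ((5 / 6 : ℝ) + j) * (7 / 6 + j) / ((1 / 2 + j) * (3 / 2 + j))) *
        ∑' k, hypTerm (1 / 2 + n) k := by
  induction n with
  | zero => simp
  | succ n ih =>
    rw [ih, prod_range_succ, mul_assoc]
    congr 1
    have h := tsum_hypTerm_contiguous (by positivity : (0 : ℝ) < 1 / 2 + n)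
    rw [div_mul_eq_mul_div, eq_div_iff (by positivity)]
    push_cast
    rw [← add_assoc]
    linear_combination h

lemma hypTerm_succ_half_add_le (n k : ℕ) :
    hypTerm (1 / 2 + n) (k + 1) ≤ hypTerm (1 / 2) (k + 1) * (1 / ((n : ℝ) + 1)) := by
  have hn : (0 : ℝ) ≤ n := n.cast_nonneg
  induction k with
  | zero =>
    simp only [hypTerm_succ, hypTerm_zero]
    norm_num
    rw [← div_eq_mul_inv, div_le_div_iff₀ (by positivity) (by positivity)]
    linarith
  | succ k ih =>
    rw [hypTerm_succ _ (k + 1), hypTerm_succ _ (k + 1), mul_right_comm]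
    have h0 := sub_third_mul_sub_two_thirds_pos (k + 1)
    have h1 := hypTerm_pos (by norm_num : (0 : ℝ) < 1 / 2) (k + 1)
    refine mul_le_mul ih ?_ (by positivity) (by positivity)
    refine div_le_div_of_nonneg_left h0.le (by positivity) ?_
    gcongr
    linarith

lemma tendsto_tsum_hypTerm :
    Tendsto (fun n : ℕ => ∑' k, hypTerm (1 / 2 + n) k) atTop (𝓝 1) := by
  have hs : ∀ n : ℕ, Summable (hypTerm (1 / 2 + n)) := fun n => summable_hypTerm (by positivity)
  have hh := (summable_nat_add_iff 1).2
    (summable_hypTerm (by norm_num : (0 : ℝ) < 1 / 2))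
  have h : Tendsto (fun n : ℕ => 1 + (∑' k, hypTerm (1 / 2) (k + 1)) * (1 / ((n : ℝ) + 1)))
      atTop (𝓝 1) := by
    simpa using ((tendsto_one_div_add_atTop_nhds_zero_nat (𝕜 := ℝ)).const_mul
      (∑' k, hypTerm (1 / 2) (k + 1))).const_add 1
  refine tendsto_of_tendsto_of_tendsto_of_le_of_le tendsto_const_nhds h (fun n => ?_) fun n => ?_
  · simp only [(hs n).tsum_eq_zero_add, hypTerm_zero]
    exact le_add_of_nonneg_right (tsum_nonneg fun k => (hypTerm_pos (by positivity) _).le)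
  · simp only [(hs n).tsum_eq_zero_add, hypTerm_zero]
    rw [← tsum_mul_right]
    refine (add_le_add_iff_left 1).2 ?_
    exact Summable.tsum_le_tsum (hypTerm_succ_half_add_le n)
      ((summable_nat_add_iff 1).2 (hs n)) (hh.mul_right _)

lemma gamma_quotient :
    Real.Gamma (1 / 2) * Real.Gamma (3 / 2) / (Real.Gamma (5 / 6) * Real.Gamma (7 / 6)) =
      3 / 2 := by
  have h1 : Real.Gamma (3 / 2) = 1 / 2 * Real.Gamma (1 / 2) := by
    rw [← Real.Gamma_add_one (by norm_num)]; norm_num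
  have h2 : Real.Gamma (7 / 6) = 1 / 6 * Real.Gamma (1 / 6) := by
    rw [← Real.Gamma_add_one (by norm_num)]; norm_num
  have h3 : Real.Gamma (1 / 6) * Real.Gamma (5 / 6) = 2 * Real.pi := by
    have h := Real.Gamma_mul_Gamma_one_sub (1 / 6)
    rw [show Real.pi * (1 / 6) = Real.pi / 6 by ring, Real.sin_pi_div_six] at h
    norm_num at h ⊢
    linarith
  have h4 : Real.Gamma (1 / 2) * Real.Gamma (1 / 2) = Real.pi := by
    rw [Real.Gamma_one_half_eq, Real.mul_self_sqrt Real.pi_pos.le]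
  have hp := Real.pi_pos
  rw [h1, h2, div_eq_iff]
  · linear_combination 1 / 2 * h4 - 1 / 4 * h3
  · intro h0
    have : Real.Gamma (1 / 6) * Real.Gamma (5 / 6) = 0 := by linear_combination 6 * h0
    linarith

lemma tendsto_prod_gamma :
    Tendsto (fun n : ℕ => ∏ j ∈ range n,
      ((5 / 6 : ℝ) + j) * (7 / 6 + j) / ((1 / 2 + j) * (3 / 2 + j))) atTop (𝓝 (3 / 2)) := by
  rw [← tendsto_add_atTop_iff_nat 1]
  have h := ((Real.GammaSeq_tendsto_Gamma (1 / 2)).mul (Real.GammaSeq_tendsto_Gamma (3 / 2))).div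
    ((Real.GammaSeq_tendsto_Gamma (5 / 6)).mul (Real.GammaSeq_tendsto_Gamma (7 / 6)))
    (mul_ne_zero (Real.Gamma_pos_of_pos (by norm_num)).ne'
      (Real.Gamma_pos_of_pos (by norm_num)).ne')
  rw [gamma_quotient] at h
  refine h.congr' ?_
  filter_upwards [eventually_gt_atTop 0] with n hn
  have hn' : (0 : ℝ) < n := by exact_mod_cast hn
  have hpow : (n : ℝ) ^ (1 / 2 : ℝ) * (n : ℝ) ^ (3 / 2 : ℝ) =
      (n : ℝ) ^ (5 / 6 : ℝ) * (n : ℝ) ^ (7 / 6 : ℝ) := by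
    rw [← Real.rpow_add hn', ← Real.rpow_add hn']; norm_num
  have hprod : ∀ s : ℝ, 0 < s → ∏ j ∈ range (n + 1), (s + j) ≠ 0 := fun s hs =>
    (prod_pos fun j _ => by positivity).ne'
  have a1 := hprod (1 / 2) (by norm_num)
  have a2 := hprod (3 / 2) (by norm_num)
  have a3 := hprod (5 / 6) (by norm_num)
  have a4 := hprod (7 / 6) (by norm_num)
  have hf : (n.factorial : ℝ) ≠ 0 := by positivity
  have p3 := (Real.rpow_pos_of_pos hn' (5 / 6)).ne'
  have p4 := (Real.rpow_pos_of_pos hn' (7 / 6)).ne'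
  simp only [Pi.div_apply, Real.GammaSeq, prod_div_distrib, prod_mul_distrib]
  generalize ∏ j ∈ range (n + 1), ((1 / 2 : ℝ) + j) = A at *
  generalize ∏ j ∈ range (n + 1), ((3 / 2 : ℝ) + j) = B at *
  generalize ∏ j ∈ range (n + 1), ((5 / 6 : ℝ) + j) = C at *
  generalize ∏ j ∈ range (n + 1), ((7 / 6 : ℝ) + j) = D at *
  generalize (n : ℝ) ^ (1 / 2 : ℝ) = w at *
  generalize (n : ℝ) ^ (3 / 2 : ℝ) = x at *
  generalize (n : ℝ) ^ (5 / 6 : ℝ) = y at *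
  generalize (n : ℝ) ^ (7 / 6 : ℝ) = z at *
  generalize (n.factorial : ℝ) = f at *
  calc w * f / A * (x * f / B) / (y * f / C * (z * f / D))
      = (w * x) * (C * D) / ((y * z) * (A * B)) := by field_simp
    _ = C * D / (A * B) := by rw [hpow]; field_simp

lemma tsum_hypTerm_half : ∑' k, hypTerm (1 / 2) k = 3 / 2 := by
  have h := tendsto_prod_gamma.mul tendsto_tsum_hypTerm
  simp_rw [← tsum_hypTerm_half_eq_prod_mul, mul_one] at h
  exact tendsto_nhds_unique tendsto_const_nhds h

lemma q2_succ (k : ℕ) :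
    q2 (k + 1) = q2 k * (((k : ℚ) + 1 - 1 / 3) * (k + 1 - 2 / 3) /
      ((1 / 2 + (k + 1)) * (k + 1 + 1))) := by
  rcases k with _ | k
  · norm_num [q2, Z2, Nat.factorial]
  · have e1 : 3 * (k + 1 + 1 + 1) - 4 = 3 * k + 1 + 1 + 1 + 1 + 1 := by omega
    have e2 : 3 * (k + 1 + 1) - 4 = 3 * k + 1 + 1 := by omega
    have e3 : k + 1 + 1 + 1 - 2 = k + 1 := by omega
    have e4 : k + 1 + 1 - 2 = k := by omega
    have e5 : 2 * (k + 1 + 1 + 1) = 2 * (k + 1 + 1) + 1 + 1 := by ring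
    have f1 : k + 1 + 1 + 1 ≠ 1 := by omega
    have f2 : k + 1 + 1 ≠ 1 := by omega
    simp only [q2, Z2, if_neg f1, if_neg f2, e1, e2, e3, e4, e5]
    rw [Nat.factorial_succ (3 * k + 1 + 1 + 1 + 1), Nat.factorial_succ (3 * k + 1 + 1 + 1),
      Nat.factorial_succ (3 * k + 1 + 1), Nat.factorial_succ k,
      Nat.factorial_succ (2 * (k + 1 + 1) + 1), Nat.factorial_succ (2 * (k + 1 + 1))]
    have g1 := (Nat.cast_ne_zero (R := ℚ)).2 (Nat.factorial_ne_zero k)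
    have g2 := (Nat.cast_ne_zero (R := ℚ)).2 (Nat.factorial_ne_zero (2 * (k + 1 + 1)))
    push_cast
    generalize (Nat.factorial (2 * (k + 1 + 1)) : ℚ) = A at *
    generalize (Nat.factorial (3 * k + 1 + 1) : ℚ) = B at *
    generalize (Nat.factorial k : ℚ) = C at *
    rw [pow_succ (8 : ℚ) (k + 1 + 1), pow_succ (54 : ℚ) (k + 1)]
    field_simp
    ring

lemma q2_eq_hypTerm (k : ℕ) : (q2 k : ℝ) = 1 / 4 * hypTerm (1 / 2) (k + 1) := by
  induction k with
  | zero => norm_num [q2, Z2, hypTerm]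
  | succ k ih =>
    rw [q2_succ, hypTerm_succ _ (k + 1)]
    push_cast
    rw [ih, mul_assoc]

lemma hasSum_q2 : HasSum (fun k => (q2 k : ℝ)) (1 / 8) := by
  have hs := summable_hypTerm (by norm_num : (0 : ℝ) < 1 / 2)
  have h := (((summable_nat_add_iff 1).2 hs).hasSum).mul_left (1 / 4 : ℝ)
  have ht := hs.tsum_eq_zero_add
  rw [tsum_hypTerm_half, hypTerm_zero] at ht
  simp_rw [q2_eq_hypTerm]
  have h8 : 1 / 4 * ∑' k, hypTerm (1 / 2) (k + 1) = 1 / 8 := by linarith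
  rwa [h8] at h

/-- With `q_{2k1+1,2k2+1} = (ρ/α)² q_{2k1} q_{2k2} = (8/3) q_{2k1} q_{2k2}`, the
two-sided peeling probabilities sum to `1/24`:
`∑_{k1,k2 ≥ 0} q_{2k1+1,2k2+1} = 1/24`. -/
theorem sum_q_two_sided :
    ∑' kk : ℕ × ℕ, ((8 : ℝ) / 3 * (q2 kk.1 : ℝ) * (q2 kk.2 : ℝ)) = 1 / 24 := by
  have hn : Summable fun k => ‖(q2 k : ℝ)‖ := hasSum_q2.summable.norm
  have h := tsum_mul_tsum_of_summable_norm hn hn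
  simp_rw [mul_assoc]
  rw [tsum_mul_left, ← h, hasSum_q2.tsum_eq]
  norm_num
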